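/- Let M₁ be the Turing machine with states {A,B,C,H} and symbols {0,1,2} whose transition table is: δ(A,0)=(1,R,B), δ(A,1)=(2,L,A), δ(A,2)=(1,L,C); δ(B,0)=(0,L,A), δ(B,1)=(2,R,B), δ(B,2)=(1,L,B); δ(C,0)=(1,R,H), δ(C,1)=(1,R,A), δ(C,2)=(1,R,C). Then, started on a blank tape, M₁ halts: ^ω0 (A0) 0^ω ⊢(119112334170342540) ^ω0 1 (H1) 2^{374676381} 0^ω. In particular M₁ halts in exactly 119,112,334,170,342,540 steps and its halting configuration carries exactly 374,676,383 non-blank symbols. -/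

import Mathlib

open Turing

inductive TSt where | A | B | C | H
deriving DecidableEq

inductive Gam where | s0 | s1 | s2
deriving DecidableEq

instance : Inhabited Gam := ⟨Gam.s0⟩

abbrev Cfg := TSt × Tape Gam

/-- The transition table of the machine (values from the halting state `H` are never used). -/
def delta : TSt → Gam → Gam × Dir × TSt
  | .A, .s0 => (.s1, Dir.right, .B)
  | .A, .s1 => (.s2, Dir.left, .A)
  | .A, .s2 => (.s1, Dir.left, .C)
  | .B, .s0 => (.s0, Dir.left, .A)
  | .B, .s1 => (.s2, Dir.right, .B)
  | .B, .s2 => (.s1, Dir.left, .B)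
  | .C, .s0 => (.s1, Dir.right, .H)
  | .C, .s1 => (.s1, Dir.right, .A)
  | .C, .s2 => (.s1, Dir.right, .C)
  | .H, a => (a, Dir.right, .H)

/-- One computation step; `none` if the current state is the halting state `H`. -/
def step (c : Cfg) : Option Cfg :=
  if c.1 = TSt.H then none
  else
    let t := delta c.1 c.2.head
    some (t.2.2, (c.2.write t.1).move t.2.1)

/-- `reaches t c₁ c₂` : iterating `step` exactly `t` times starting from `c₁` yields `c₂`. -/
def reaches (t : ℕ) (c₁ c₂ : Cfg) : Prop :=
  (fun c => Option.bind c step)^[t] (some c₁) = some c₂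

/-- The configuration `^ω0 x (q a) y 0^ω` : state `q`, head reading `a`, the word `x`
written immediately to the left of the head (in order), `y` immediately to the right,
blank elsewhere. -/
def mkCfg (x : List Gam) (q : TSt) (a : Gam) (y : List Gam) : Cfg :=
  (q, ⟨a, ListBlank.mk x.reverse, ListBlank.mk y⟩)

theorem reaches.trans {s t : ℕ} {a b c : Cfg} (h₁ : reaches s a b) (h₂ : reaches t b c) :
    reaches (s + t) a c := by
  unfold reaches at *
  rw [Nat.add_comm, Function.iterate_add_apply, h₁, h₂]

theorem reaches.of_eq {s t : ℕ} {a b : Cfg} (h : reaches s a b) (e : s = t) : reaches t a b :=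
  e ▸ h

theorem reaches.zero (a : Cfg) : reaches 0 a a := rfl

/-- The head sits on the first cell of the left half-tape `L`. -/
def onLeft (q : TSt) (L R : ListBlank Gam) : Cfg := (q, ⟨L.head, L.tail, R⟩)

/-- The head sits on the first cell of the right half-tape `R`. -/
def onRight (q : TSt) (L R : ListBlank Gam) : Cfg := (q, ⟨R.head, L, R.tail⟩)

/-- The configuration after writing `b` between the half-tapes `L` and `R` and moving away. -/
def moved (q : TSt) (L R : ListBlank Gam) (b : Gam) : Dir → Cfg
  | Dir.left => onLeft q L (R.cons b)
  | Dir.right => onRight q (L.cons b) R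

theorem reaches_one_onLeft (q : TSt) (hq : q ≠ .H) (a : Gam) (L R : ListBlank Gam) :
    reaches 1 (onLeft q (L.cons a) R)
      (moved (delta q a).2.2 L R (delta q a).1 (delta q a).2.1) := by
  rcases h : delta q a with ⟨b, d, q'⟩
  cases d <;>
    simp [reaches, onLeft, onRight, moved, step, hq, h, Tape.write, Tape.move]

theorem reaches_one_onRight (q : TSt) (hq : q ≠ .H) (a : Gam) (L R : ListBlank Gam) :
    reaches 1 (onRight q L (R.cons a))
      (moved (delta q a).2.2 L R (delta q a).1 (delta q a).2.1) := by
  rcases h : delta q a with ⟨b, d, q'⟩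
  cases d <;>
    simp [reaches, onLeft, onRight, moved, step, hq, h, Tape.write, Tape.move]

theorem reaches_succ_onLeft {q q' : TSt} (hq : q ≠ .H) {a b : Gam} {d : Dir}
    (hd : delta q a = (b, d, q')) {L R : ListBlank Gam} {t : ℕ} {c : Cfg}
    (h : reaches t (moved q' L R b d) c) : reaches (t + 1) (onLeft q (L.cons a) R) c := by
  have h' := reaches_one_onLeft q hq a L R
  rw [hd] at h'
  exact (h'.trans h).of_eq (Nat.add_comm _ _)

theorem reaches_succ_onRight {q q' : TSt} (hq : q ≠ .H) {a b : Gam} {d : Dir}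
    (hd : delta q a = (b, d, q')) {L R : ListBlank Gam} {t : ℕ} {c : Cfg}
    (h : reaches t (moved q' L R b d) c) : reaches (t + 1) (onRight q L (R.cons a)) c := by
  have h' := reaches_one_onRight q hq a L R
  rw [hd] at h'
  exact (h'.trans h).of_eq (Nat.add_comm _ _)

/-- The blank half-tape. -/
def blank : ListBlank Gam := ListBlank.mk []

theorem cons_blank : blank.cons .s0 = blank :=
  Quotient.sound (Or.inr ⟨1, rfl⟩)

/-- Prepend `n` copies of `a` to a half-tape. -/
def rep (a : Gam) : ℕ → ListBlank Gam → ListBlank Gam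
  | 0, L => L
  | n + 1, L => (rep a n L).cons a

theorem rep_cons (a : Gam) (n : ℕ) (L : ListBlank Gam) :
    rep a n (L.cons a) = rep a (n + 1) L := by
  induction n with
  | zero => rfl
  | succ n ih => rw [rep, ih]; rfl

theorem mk_replicate (a : Gam) (n : ℕ) : ListBlank.mk (List.replicate n a) = rep a n blank := by
  induction n with
  | zero => rfl
  | succ n ih => rw [List.replicate_succ, rep, ← ih, ListBlank.cons_mk]

theorem sweep_A (n : ℕ) (L R : ListBlank Gam) :
    reaches n (onLeft .A (rep .s1 n L) R) (onLeft .A L (rep .s2 n R)) := by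
  induction n generalizing R with
  | zero => exact .zero _
  | succ n ih =>
    rw [← rep_cons .s2]
    exact reaches_succ_onLeft (by decide) rfl (ih _)

theorem sweep_B_left (n : ℕ) (L R : ListBlank Gam) :
    reaches n (onLeft .B (rep .s2 n L) R) (onLeft .B L (rep .s1 n R)) := by
  induction n generalizing R with
  | zero => exact .zero _
  | succ n ih =>
    rw [← rep_cons .s1]
    exact reaches_succ_onLeft (by decide) rfl (ih _)

theorem sweep_B_right (n : ℕ) (L R : ListBlank Gam) :
    reaches n (onRight .B L (rep .s1 n R)) (onRight .B (rep .s2 n L) R) := by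
  induction n generalizing L with
  | zero => exact .zero _
  | succ n ih =>
    rw [← rep_cons .s2]
    exact reaches_succ_onRight (by decide) rfl (ih _)

theorem bounce (n : ℕ) (L R : ListBlank Gam) :
    reaches (2 * n + 3) (onRight .B (rep .s2 n (L.cons .s1)) (R.cons .s2))
      (onRight .B (rep .s2 (n + 2) L) R) := by
  refine reaches.of_eq (reaches_succ_onRight (by decide) rfl ((sweep_B_left n _ _).trans
    (reaches_succ_onLeft (t := n + 1) (by decide) rfl ?_))) (by omega)
  have h := sweep_B_right (n + 1) (L.cons .s2) R
  rw [← rep_cons .s1, rep_cons .s2] at h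
  exact h

/-- Starting left of the word `W`, the machine builds `111` and enters `W` from the left. -/
theorem enter (W : ListBlank Gam) :
    reaches 13 (onLeft .B blank W) (onRight .B (rep .s1 3 blank) W) := by
  rw [← cons_blank]
  refine reaches_succ_onLeft (by decide) rfl ?_
  rw [← cons_blank]
  refine reaches_succ_onLeft (by decide) rfl ?_
  refine reaches_succ_onRight (by decide) rfl ?_
  refine reaches_succ_onLeft (by decide) rfl ?_
  rw [← cons_blank]
  refine reaches_succ_onLeft (by decide) rfl ?_
  refine reaches_succ_onRight (by decide) rfl ?_
  refine reaches_succ_onLeft (by decide) rfl ?_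
  refine reaches_succ_onRight (by decide) rfl ?_
  refine reaches_succ_onRight (by decide) rfl ?_
  refine reaches_succ_onLeft (by decide) rfl ?_
  refine reaches_succ_onLeft (by decide) rfl ?_
  refine reaches_succ_onRight (by decide) rfl ?_
  refine reaches_succ_onRight (by decide) rfl ?_
  simp only [cons_blank]
  exact .zero _

theorem convert_four (a b : ℕ) :
    reaches (8 * a + 41) (onLeft .B blank (rep .s1 a (rep .s2 (b + 4) blank)))
      (onLeft .B blank (rep .s1 (a + 7) (rep .s2 b blank))) := by
  refine reaches.of_eq ((enter _).trans ((sweep_B_right _ _ _).trans ((bounce _ _ _).trans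
    ((bounce _ _ _).trans ((bounce _ _ _).trans
      (reaches_succ_onRight (t := a + 6) (by decide) rfl ?_)))))) (by omega)
  rw [← rep_cons .s1 (a + 6)]
  exact sweep_B_left _ _ _

theorem convert_all (q r : ℕ) :
    reaches (28 * q ^ 2 + 37 * q) (onLeft .B blank (rep .s1 3 (rep .s2 (4 * q + r) blank)))
      (onLeft .B blank (rep .s1 (7 * q + 3) (rep .s2 r blank))) := by
  induction q generalizing r with
  | zero => simpa using reaches.zero _
  | succ q ih =>
    have h := ih (r + 4)
    rw [show 4 * q + (r + 4) = 4 * (q + 1) + r by ring] at h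
    exact (h.trans (convert_four _ _)).of_eq (by ring)

theorem bounces (r j a : ℕ) :
    reaches (2 * r * a + 2 * r ^ 2 + r)
      (onRight .B (rep .s2 a (rep .s1 (j + r) blank)) (rep .s2 r blank))
      (onRight .B (rep .s2 (a + 2 * r) (rep .s1 j blank)) blank) := by
  induction r generalizing a with
  | zero => simpa using! reaches.zero _
  | succ r ih =>
    have h := (bounce a (rep .s1 (j + r) blank) (rep .s2 r blank)).trans (ih (a + 2))
    rw [show a + 2 + 2 * r = a + 2 * (r + 1) by ring] at h
    exact h.of_eq (by ring)

theorem turn (m : ℕ) (L : ListBlank Gam) :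
    reaches 9 (onRight .B (rep .s2 (m + 2) L) blank)
      (onLeft .A (rep .s2 m L) (rep .s2 3 blank)) := by
  rw [← cons_blank]
  refine reaches_succ_onRight (by decide) rfl ?_
  refine reaches_succ_onLeft (by decide) rfl ?_
  refine reaches_succ_onLeft (by decide) rfl ?_
  refine reaches_succ_onRight (by decide) rfl ?_
  refine reaches_succ_onRight (by decide) rfl ?_
  rw [← cons_blank]
  refine reaches_succ_onRight (by decide) rfl ?_
  change reaches 3 (onLeft .A (rep .s1 3 (rep .s2 m L)) (blank.cons .s0)) _
  simp only [cons_blank]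
  exact sweep_A 3 _ _

theorem move_two (m k : ℕ) (L : ListBlank Gam) :
    reaches 8 (onLeft .A (rep .s2 (m + 2) L) (rep .s2 (k + 1) blank))
      (onLeft .A (rep .s2 m L) (rep .s2 (k + 3) blank)) := by
  refine reaches_succ_onLeft (by decide) rfl ?_
  refine reaches_succ_onLeft (by decide) rfl ?_
  refine reaches_succ_onRight (by decide) rfl ?_
  refine reaches_succ_onRight (by decide) rfl ?_
  refine reaches_succ_onLeft (by decide) rfl ?_
  refine reaches_succ_onRight (by decide) rfl ?_
  exact sweep_A 2 _ _

theorem move_pairs (p e k : ℕ) (L : ListBlank Gam) :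
    reaches (8 * p) (onLeft .A (rep .s2 (2 * p + e) L) (rep .s2 (k + 1) blank))
      (onLeft .A (rep .s2 e L) (rep .s2 (2 * p + k + 1) blank)) := by
  induction p generalizing k with
  | zero => simpa using reaches.zero _
  | succ p ih =>
    have h := (move_two (2 * p + e) k L).trans (ih (k + 2))
    rw [show 2 * p + e + 2 = 2 * (p + 1) + e by ring,
      show 2 * p + (k + 2) + 1 = 2 * (p + 1) + k + 1 by ring] at h
    exact h.of_eq (by ring)

/-- The head reads a blank cell, followed to its right by exactly `n` symbols `2`. -/
def block (n : ℕ) : Cfg := onLeft .A blank (rep .s2 n blank)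

theorem block_start (m : ℕ) :
    reaches 7 (block (m + 2)) (onLeft .B blank (rep .s1 3 (rep .s2 m blank))) := by
  unfold block
  rw [← cons_blank]
  refine reaches_succ_onLeft (by decide) rfl ?_
  refine reaches_succ_onRight (by decide) rfl ?_
  refine reaches_succ_onLeft (by decide) rfl ?_
  refine reaches_succ_onRight (by decide) rfl ?_
  refine reaches_succ_onRight (by decide) rfl ?_
  simp only [cons_blank]
  exact sweep_B_left 2 _ _

/-- The number of steps before the parity of the intermediate block matters. -/
def commonCost (q r p : ℕ) : ℕ :=
  28 * q ^ 2 + 44 * q + 32 + (2 * r * (7 * q + 3) + 2 * r ^ 2 + r) + 8 * p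

theorem block_common {q r j p e : ℕ} (hj : j + r = 3) (hp : 7 * q + 2 * r + 1 = 2 * p + e) :
    reaches (commonCost q r p) (block (4 * q + r + 2))
      (onLeft .A (rep .s2 e (rep .s1 j blank)) (rep .s2 (2 * p + 3) blank)) := by
  have h := bounces r j (7 * q + 3)
  rw [show 7 * q + 3 + 2 * r = 2 * p + e + 2 by omega, hj] at h
  exact ((block_start _).trans ((convert_all q r).trans ((enter _).trans ((sweep_B_right _ _ _).trans
    (h.trans ((turn _ _).trans (move_pairs p e 2 _))))))).of_eq (by unfold commonCost; ring)

theorem onLeft_rep_one_reaches_block (j k : ℕ) :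
    reaches j (onLeft .A (rep .s1 j blank) (rep .s2 k blank)) (block (j + k)) := by
  have h := sweep_A j blank (rep .s2 k blank)
  have e : rep .s2 j (rep .s2 k blank) = rep .s2 (j + k) blank := by
    clear h
    induction j with
    | zero => simp [rep]
    | succ j ih => rw [rep, ih, Nat.succ_add, rep]
  rwa [e] at h

theorem block_even {q r j p : ℕ} (hj : j + r = 3) (hp : 7 * q + 2 * r + 1 = 2 * p) :
    reaches (commonCost q r p + j) (block (4 * q + r + 2)) (block (7 * q + r + 7)) := by
  have h := (block_common hj (e := 0) hp).trans (onLeft_rep_one_reaches_block _ _)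
  rwa [show j + (2 * p + 3) = 7 * q + r + 7 by omega] at h

theorem block_odd {q r j p : ℕ} (hj : j + 1 + r = 3) (hp : 7 * q + 2 * r + 1 = 2 * p + 1) :
    reaches (commonCost q r p + (j + 4)) (block (4 * q + r + 2)) (block (7 * q + r + 7)) := by
  have h := (block_common hj hp).trans (reaches_succ_onLeft (by decide) rfl
    (reaches_succ_onLeft (by decide) rfl (reaches_succ_onRight (by decide) rfl
      (onLeft_rep_one_reaches_block (j + 1) (2 * p + 4)))))
  rwa [show j + 1 + (2 * p + 4) = 7 * q + r + 7 by omega] at h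

theorem block_halt {q p : ℕ} (hp : 7 * q + 7 = 2 * p + 1) :
    reaches (commonCost q 3 p + 2) (block (4 * q + 5))
      (onRight .H (blank.cons .s1) ((rep .s2 (2 * p + 3) blank).cons .s1)) := by
  refine (block_common (r := 3) (j := 0) rfl hp).trans (reaches_succ_onLeft (by decide) rfl ?_)
  simp only [rep]
  rw [← cons_blank]
  refine reaches_succ_onLeft (by decide) rfl ?_
  simp only [cons_blank]
  exact .zero _

/-- The action of the machine on pairs (block length, elapsed steps), away from halting. -/
def cycle (c : ℕ × ℕ) : ℕ × ℕ :=
  let q := (c.1 - 2) / 4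
  let r := (c.1 - 2) % 4
  let m := 7 * q + 2 * r + 1
  (7 * q + r + 7, c.2 + (commonCost q r (m / 2) + (3 - r + 3 * (m % 2))))

theorem reaches_cycle {c₀ : Cfg} {x : ℕ × ℕ} (h : reaches x.2 c₀ (block x.1)) (h₂ : 2 ≤ x.1)
    (h₅ : x.1 % 8 ≠ 5) : reaches (cycle x).2 c₀ (block (cycle x).1) := by
  obtain ⟨n, t⟩ := x
  simp only [cycle] at *
  refine h.trans ?_
  generalize hq : (n - 2) / 4 = q
  generalize hr : (n - 2) % 4 = r
  obtain rfl : n = 4 * q + r + 2 := by omega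
  rcases Nat.mod_two_eq_zero_or_one (7 * q + 2 * r + 1) with hm | hm
  · exact (block_even (j := 3 - r) (p := (7 * q + 2 * r + 1) / 2) (by omega)
      (by omega)).of_eq (by omega)
  · exact (block_odd (j := 2 - r) (p := (7 * q + 2 * r + 1) / 2) (by omega)
      (by omega)).of_eq (by rw [hm]; omega)

theorem reaches_cycle_iterate {c₀ : Cfg} {x : ℕ × ℕ} (h : reaches x.2 c₀ (block x.1)) (k : ℕ)
    (hk : ∀ i < k, 2 ≤ (cycle^[i] x).1 ∧ (cycle^[i] x).1 % 8 ≠ 5) :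
    reaches (cycle^[k] x).2 c₀ (block (cycle^[k] x).1) := by
  induction k with
  | zero => exact h
  | succ k ih =>
    rw [Function.iterate_succ_apply']
    exact reaches_cycle (ih fun i hi => hk i (hi.trans k.lt_succ_self))
      (hk k k.lt_succ_self).1 (hk k k.lt_succ_self).2

theorem block_zero : reaches 16 (block 0) (block 3) := by
  unfold block
  simp only [rep]
  rw [← cons_blank]
  refine reaches_succ_onLeft (by decide) rfl ?_
  refine reaches_succ_onRight (by decide) rfl ?_
  refine reaches_succ_onLeft (by decide) rfl ?_
  rw [← cons_blank]
  refine reaches_succ_onLeft (by decide) rfl ?_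
  refine reaches_succ_onRight (by decide) rfl ?_
  refine reaches_succ_onLeft (by decide) rfl ?_
  refine reaches_succ_onRight (by decide) rfl ?_
  refine reaches_succ_onRight (by decide) rfl ?_
  refine reaches_succ_onLeft (by decide) rfl ?_
  refine reaches_succ_onLeft (by decide) rfl ?_
  refine reaches_succ_onRight (by decide) rfl ?_
  refine reaches_succ_onRight (by decide) rfl ?_
  refine reaches_succ_onRight (by decide) rfl ?_
  simp only [moved, cons_blank]
  exact sweep_A 3 _ _

theorem stmt1 :
    reaches 119112334170342540 (mkCfg [] .A .s0 [])
      (mkCfg [.s1] .H .s1 (List.replicate 374676381 .s2)) := by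
  have h := reaches_cycle_iterate (x := (3, 16)) block_zero 31 (by decide +kernel)
  have e : cycle^[31] (3, 16) = (214100789, 38893823076994451) := by decide +kernel
  rw [e] at h
  have h' := (h.trans (block_halt (q := 53525196) (p := 187338189) (by norm_num))).of_eq
    (t := 119112334170342540) (by norm_num [commonCost])
  have hf : mkCfg [.s1] .H .s1 (List.replicate 374676381 .s2) =
      onRight .H (blank.cons .s1) ((rep .s2 (2 * 187338189 + 3) blank).cons .s1) := by
    simp only [mkCfg, onRight, mk_replicate, ListBlank.head_cons, ListBlank.tail_cons]
    rfl
  rw [hf]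
  exact h'
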